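/- Assume (H1), (H2), upper Ahlfors regularity (H4′) and lower Ahlfors regularity (H4″). Let x̄₀ ∈ Γ and suppose there exist δ′, ρ′ > 0 and ω < t − n(θ_Γ(x̄₀) − 1) such that ∂Ω ∩ B(x̄₀, ρ′) ⊆ A_{ω,δ′} ∩ Γ_t. Let Tu : Γ ∩ B(x̄₀,ρ′) → ℝ be H^t-measurable and such that for every x̄ ∈ Γ ∩ B(x̄₀,ρ′), g(x;u) → Tu(x̄) as x → x̄ with x ∈ Q_{λ₀}(x̄). Then lim_{ρ→0⁺} ⨍_{Ω∩B(x̄₀,ρ)} |Tu(x̄₀) − u(x)|ᵖ dx = 0. -/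

import Mathlib

open MeasureTheory Metric Set Filter
open scoped ENNReal NNReal Topology

noncomputable section

abbrev Euc (n : ℕ) := EuclideanSpace ℝ (Fin n)

variable {n : ℕ}

/-- Distance to the boundary of `Ω`. -/
def dB (Ω : Set (Euc n)) (x : Euc n) : ℝ := infDist x (frontier Ω)

/-- `Ψ(x) = B(x, d(x)/2)`. -/
def PsiB (Ω : Set (Euc n)) (x : Euc n) : Set (Euc n) := ball x (dB Ω x / 2)

/-- `Φ(x) = B(x, d(x)/6)`. -/
def PhiB (Ω : Set (Euc n)) (x : Euc n) : Set (Euc n) := ball x (dB Ω x / 6)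

/-- The integrand of `ν(·;u)`. -/
def nuInt (Ω : Set (Euc n)) (s : Euc n → ℝ) (p : ℝ) (u : Euc n → ℝ) (x : Euc n) : ℝ :=
  (⨍ y in PsiB Ω x, |u y - u x|) ^ p * dB Ω x ^ (-(p * s x))

/-- `ν(E;u)`. -/
def nuM (Ω : Set (Euc n)) (s : Euc n → ℝ) (p : ℝ) (u : Euc n → ℝ) (E : Set (Euc n)) : ℝ :=
  ∫ x in Ω ∩ E, nuInt Ω s p u x

/-- Membership in the nonlocal space `𝒩^{s,p}(Ω)`: `u ∈ L¹(Ω)` and `ν(Ω;u) < ∞`. -/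
def MemN (Ω : Set (Euc n)) (s : Euc n → ℝ) (p : ℝ) (u : Euc n → ℝ) : Prop :=
  IntegrableOn u Ω volume ∧ IntegrableOn (nuInt Ω s p u) Ω volume

/-- `g(x;u)`, the mean of `u` over `Φ(x)`. -/
def gFun (Ω : Set (Euc n)) (u : Euc n → ℝ) (x : Euc n) : ℝ := ⨍ y in PhiB Ω x, u y

/-- The approach region `Q^θ_λ(xb)`. -/
def Qreg (Ω : Set (Euc n)) (lam θ : ℝ) (xb : Euc n) : Set (Euc n) :=
  {x | x ∈ Ω ∧ (lam * dist xb x) ^ θ < dB Ω x}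

/-- `Q` is an `(η,θ)`-corkscrew region for `xb` with radius `δ₀`. -/
def IsCorkscrew (Ω Q : Set (Euc n)) (xb : Euc n) (η θ δ₀ : ℝ) : Prop :=
  ∀ δ : ℝ, 0 < δ → δ ≤ δ₀ →
    ∃ x ∈ Q, η * δ < dist xb x ∧ dist xb x < δ ∧ (η * δ) ^ θ < dB Ω x

/-- `E` is `(C,θ)`-connected to `xb`, with radius `ρ₀` and gauge `ε`. -/
def ConnectedTo (Ω E : Set (Euc n)) (xb : Euc n) (C θ ρ₀ : ℝ) (ε : ℝ → ℝ) : Prop :=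
  ∀ lam : ℝ, 0 < lam → lam < 1 →
    0 < ε lam ∧ ε lam ≤ lam ∧
      ∀ ρ : ℝ, 0 < ρ → ρ ≤ ρ₀ → ∀ x ∈ E ∩ ball xb ρ, ∀ x' ∈ E ∩ ball xb ρ,
        (lam * ρ) ^ θ ≤ dB Ω x → (lam * ρ) ^ θ ≤ dB Ω x' →
        ∃ γ : ℝ → Euc n, ContinuousOn γ (Icc 0 1) ∧ γ 0 = x ∧ γ 1 = x' ∧
          (∀ τ ∈ Icc (0:ℝ) 1, γ τ ∈ E ∧ ε lam * ρ ^ θ ≤ dB Ω (γ τ)) ∧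
          eVariationOn γ (Icc 0 1) ≤ ENNReal.ofReal (C * ρ)

/-- The piecewise bilinear function `α(s,θ)`. -/
def alphaFun (n : ℕ) (p sv θ : ℝ) : ℝ :=
  if p * sv - n ≤ p - 1 then p * (1 - θ) + (p * sv - n) * θ
  else (1 - θ) + (p * sv - n)

/-- `s̲_δ(xb)`. -/
def sLow (Ω : Set (Euc n)) (s : Euc n → ℝ) (xb : Euc n) (δ : ℝ) : ℝ :=
  sInf (s '' (Ω ∩ ball xb δ))

/-- `α̲_δ(xb)`. -/
def alphaLow (Ω : Set (Euc n)) (s : Euc n → ℝ) (p : ℝ) (θΓ : Euc n → ℝ)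
    (xb : Euc n) (δ : ℝ) : ℝ :=
  alphaFun n p (sLow Ω s xb δ) (θΓ xb)

/-- `α̲_0(xb) = lim_{δ → 0⁺} α̲_δ(xb)`. -/
def alphaLow0 (Ω : Set (Euc n)) (s : Euc n → ℝ) (p : ℝ) (θΓ : Euc n → ℝ) (xb : Euc n) : ℝ :=
  limUnder (𝓝[>] (0:ℝ)) (fun δ => alphaLow Ω s p θΓ xb δ)

/-- `Γ_τ`: points of `Γ` where `limsup_{ρ→0⁺} ρ^{-τ} ν(B(xb,ρ);u) < ∞`. -/
def GammaTau (Ω : Set (Euc n)) (s : Euc n → ℝ) (p : ℝ) (u : Euc n → ℝ)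
    (Γ : Set (Euc n)) (τ : ℝ) : Set (Euc n) :=
  {xb ∈ Γ | ∃ M : ℝ, ∀ᶠ ρ in 𝓝[>] (0:ℝ), ρ ^ (-τ) * nuM Ω s p u (ball xb ρ) ≤ M}

/-- `M_τ(xb) = sup_{0<ρ≤δΓ} ρ^{-τ} ν(B(xb,ρ);u)`. -/
def Mtau (Ω : Set (Euc n)) (s : Euc n → ℝ) (p : ℝ) (u : Euc n → ℝ)
    (δΓ τ : ℝ) (xb : Euc n) : ℝ :=
  sSup ((fun ρ => ρ ^ (-τ) * nuM Ω s p u (ball xb ρ)) '' Ioc 0 δΓ)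


lemma aux_ball_subset {Ω : Set (Euc n)} {x : Euc n} (hx : x ∈ Ω) :
    ball x (dB Ω x) ⊆ Ω := by
  intro y hy
  by_contra hyΩ
  have hpc : IsPreconnected (ball x (dB Ω x)) := (convex_ball x _).isPreconnected
  have hxb : x ∈ ball x (dB Ω x) := by
    rw [mem_ball] at hy ⊢
    rw [dist_self]
    exact lt_of_le_of_lt dist_nonneg hy
  have hne : (ball x (dB Ω x) ∩ frontier Ω).Nonempty := by
    by_contra hem
    have hcov : ball x (dB Ω x) ⊆ interior Ω ∪ interior Ωᶜ := by
      rw [← compl_frontier_eq_union_interior]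
      exact fun w hw hwf => hem ⟨w, hw, hwf⟩
    have hx1 : x ∈ interior Ω := (hcov hxb).resolve_right fun h => interior_subset h hx
    have hy1 : y ∈ interior Ωᶜ := (hcov hy).resolve_left fun h => hyΩ (interior_subset h)
    obtain ⟨w, -, hw1, hw2⟩ := hpc _ _ isOpen_interior isOpen_interior hcov
      ⟨x, hxb, hx1⟩ ⟨y, hy, hy1⟩
    exact interior_subset hw2 (interior_subset hw1)
  obtain ⟨z, hz1, hz2⟩ := hne
  have := infDist_le_dist_of_mem (x := x) hz2
  rw [mem_ball, dist_comm] at hz1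
  unfold dB at hz1
  linarith

lemma aux_dB_nonneg (Ω : Set (Euc n)) (x : Euc n) : 0 ≤ dB Ω x := infDist_nonneg

lemma aux_dB_lip (Ω : Set (Euc n)) (x y : Euc n) : dB Ω x ≤ dB Ω y + dist x y :=
  infDist_le_infDist_add_dist

lemma aux_dB_pos {Ω : Set (Euc n)} (hΩ : IsOpen Ω) (hfr : (frontier Ω).Nonempty)
    {x : Euc n} (hx : x ∈ Ω) : 0 < dB Ω x := by
  have h : x ∉ frontier Ω := by
    rw [hΩ.frontier_eq]
    exact fun h => h.2 hx
  exact (isClosed_frontier.notMem_iff_infDist_pos hfr).1 h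

lemma aux_vol_ball (hn : 1 ≤ n) (x : Euc n) {r : ℝ} (hr : 0 ≤ r) :
    volume.real (ball x r) = r ^ n * volume.real (ball (0 : Euc n) 1) := by
  have : Nonempty (Fin n) := ⟨⟨0, hn⟩⟩
  have : Nontrivial (Euc n) := inferInstance
  rw [measureReal_def, Measure.addHaar_ball _ _ hr, ENNReal.toReal_mul, ENNReal.toReal_ofReal
    (by positivity), measureReal_def]
  simp

lemma aux_vol_pos : 0 < volume.real (ball (0 : Euc n) 1) := by
  rw [measureReal_def]
  exact ENNReal.toReal_pos (measure_ball_pos _ _ one_pos).ne' measure_ball_lt_top.ne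

def hFun (Ω : Set (Euc n)) (u : Euc n → ℝ) (x : Euc n) : ℝ := ⨍ y in PsiB Ω x, |u y - u x|

lemma aux_hFun_nonneg (Ω : Set (Euc n)) (u : Euc n → ℝ) (x : Euc n) : 0 ≤ hFun Ω u x := by
  unfold hFun
  rw [setAverage_eq]
  exact smul_nonneg (by positivity) (integral_nonneg fun _ => abs_nonneg _)

lemma aux_nuInt_nonneg (Ω : Set (Euc n)) (s : Euc n → ℝ) (p : ℝ) (u : Euc n → ℝ) (x : Euc n) :
    0 ≤ nuInt Ω s p u x := by
  have := aux_hFun_nonneg Ω u x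
  unfold nuInt
  exact mul_nonneg (Real.rpow_nonneg this _) (Real.rpow_nonneg (aux_dB_nonneg _ _) _)

lemma aux_hFun_pow {Ω : Set (Euc n)} (s : Euc n → ℝ) (p : ℝ) (u : Euc n → ℝ) {x : Euc n}
    (hx : 0 < dB Ω x) : hFun Ω u x ^ p = nuInt Ω s p u x * dB Ω x ^ (p * s x) := by
  unfold nuInt hFun
  rw [mul_assoc, ← Real.rpow_add hx]
  simp

/-- Pointwise comparison of `u z` with a mean over a ball of comparable size. -/
lemma aux_u_sub_g (hn : 1 ≤ n) {Ω : Set (Euc n)} {u : Euc n → ℝ} (hu : IntegrableOn u Ω volume)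
    {y z : Euc n} (hz : z ∈ Ω) (hy : 0 < dB Ω y) (hsub : PhiB Ω y ⊆ PsiB Ω z)
    (hd : dB Ω z ≤ 4 / 3 * dB Ω y) : |u z - gFun Ω u y| ≤ 4 ^ n * hFun Ω u z := by
  have hPsi : PsiB Ω z ⊆ Ω := (ball_subset_ball (by linarith [aux_dB_nonneg Ω z])).trans
    (aux_ball_subset hz)
  have hv := aux_vol_pos (n := n)
  have hdz := aux_dB_nonneg Ω z
  have hvPhi : volume.real (PhiB Ω y) = (dB Ω y / 6) ^ n * volume.real (ball (0 : Euc n) 1) :=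
    aux_vol_ball hn y (by linarith)
  have hvPsi : volume.real (PsiB Ω z) = (dB Ω z / 2) ^ n * volume.real (ball (0 : Euc n) 1) :=
    aux_vol_ball hn z (by linarith)
  have hPhipos : 0 < volume.real (PhiB Ω y) := by rw [hvPhi]; positivity
  have hfin1 : volume (PhiB Ω y) ≠ ∞ := measure_ball_lt_top.ne
  have hfin2 : volume (PsiB Ω z) ≠ ∞ := measure_ball_lt_top.ne
  have hi1 : IntegrableOn (fun w => u w - u z) (PsiB Ω z) :=
    (hu.mono_set hPsi).sub (integrableOn_const hfin2)
  have hi2 : IntegrableOn (fun w => |u w - u z|) (PsiB Ω z) := hi1.abs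
  have e1 : u z - gFun Ω u y = - ((volume.real (PhiB Ω y))⁻¹ * ∫ w in PhiB Ω y, (u w - u z)) := by
    unfold gFun
    rw [setAverage_eq, integral_sub (hu.mono_set (hsub.trans hPsi)) (integrableOn_const hfin1)]
    simp only [integral_const, smul_eq_mul, measureReal_restrict_apply_univ]
    field_simp
    ring
  have e2 : |∫ w in PhiB Ω y, (u w - u z)| ≤ ∫ w in PsiB Ω z, |u w - u z| :=
    (abs_integral_le_integral_abs).trans (setIntegral_mono_set hi2
      (ae_of_all _ fun _ => abs_nonneg _) (LE.le.eventuallyLE hsub))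
  have e3 : ∫ w in PsiB Ω z, |u w - u z| = volume.real (PsiB Ω z) * hFun Ω u z := by
    unfold hFun
    rw [setAverage_eq, smul_eq_mul]
    have : 0 < volume.real (PsiB Ω z) := lt_of_lt_of_le hPhipos (measureReal_mono hsub hfin2)
    field_simp
  rw [e1, abs_neg, abs_mul, abs_of_pos (inv_pos.2 hPhipos)]
  have hh := aux_hFun_nonneg Ω u z
  have e4 : volume.real (PsiB Ω z) ≤ 4 ^ n * volume.real (PhiB Ω y) := by
    rw [hvPhi, hvPsi, ← mul_assoc, ← mul_pow]
    gcongr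
    linarith
  calc (volume.real (PhiB Ω y))⁻¹ * |∫ w in PhiB Ω y, (u w - u z)|
      ≤ (volume.real (PhiB Ω y))⁻¹ * (4 ^ n * volume.real (PhiB Ω y) * hFun Ω u z) := by
        gcongr
        exact e2.trans (e3.le.trans (by gcongr))
    _ = 4 ^ n * hFun Ω u z := by field_simp

lemma aux_u_sub_g_self (hn : 1 ≤ n) {Ω : Set (Euc n)} {u : Euc n → ℝ}
    (hu : IntegrableOn u Ω volume) {z : Euc n} (hz : z ∈ Ω) (hd : 0 < dB Ω z) :
    |u z - gFun Ω u z| ≤ 4 ^ n * hFun Ω u z :=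
  aux_u_sub_g hn hu hz hd (ball_subset_ball (by linarith)) (by linarith)

lemma aux_g_sub_g (hn : 1 ≤ n) {Ω : Set (Euc n)} {u : Euc n → ℝ}
    (hu : IntegrableOn u Ω volume) {x y z : Euc n} (hx : x ∈ Ω) (hd : 0 < dB Ω x)
    (hxy : dist x y ≤ dB Ω x / 20) (hz : z ∈ PhiB Ω x) :
    |gFun Ω u x - gFun Ω u y| ≤ 2 * 4 ^ n * hFun Ω u z := by
  have hzd : dist z x < dB Ω x / 6 := hz
  have hzΩ : z ∈ Ω := aux_ball_subset hx (by rw [mem_ball]; linarith)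
  have h1 := aux_dB_lip Ω z x
  have h2 := aux_dB_lip Ω x z
  have h3 := aux_dB_lip Ω x y
  have h4 := aux_dB_lip Ω y x
  rw [dist_comm x z] at h2
  rw [dist_comm y x] at h4
  have a1 : |u z - gFun Ω u x| ≤ 4 ^ n * hFun Ω u z := by
    refine aux_u_sub_g hn hu hzΩ hd ?_ (by linarith)
    refine ball_subset_ball' ?_
    rw [dist_comm x z]
    linarith
  have a2 : |u z - gFun Ω u y| ≤ 4 ^ n * hFun Ω u z := by
    refine aux_u_sub_g hn hu hzΩ (by linarith) ?_ (by linarith)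
    refine ball_subset_ball' ?_
    have := dist_triangle y x z
    rw [dist_comm y x, dist_comm x z] at this
    linarith
  have := abs_sub_le (gFun Ω u x) (u z) (gFun Ω u y)
  rw [abs_sub_comm (gFun Ω u x) (u z)] at this
  linarith

lemma aux_nuM_mono {Ω : Set (Euc n)} {s : Euc n → ℝ} {p : ℝ} {u : Euc n → ℝ}
    (hu : MemN Ω s p u) {E F : Set (Euc n)} (h : E ⊆ F) :
    nuM Ω s p u E ≤ nuM Ω s p u F :=
  setIntegral_mono_set (hu.2.mono_set inter_subset_left)
    (ae_of_all _ fun x => aux_nuInt_nonneg Ω s p u x)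
    (LE.le.eventuallyLE (inter_subset_inter_right _ h))

lemma aux_nuM_nonneg {Ω : Set (Euc n)} {s : Euc n → ℝ} {p : ℝ} {u : Euc n → ℝ}
    (E : Set (Euc n)) : 0 ≤ nuM Ω s p u E :=
  integral_nonneg fun x => aux_nuInt_nonneg Ω s p u x

lemma aux_local (hn : 1 ≤ n) {Ω : Set (Euc n)} {s : Euc n → ℝ} {p sb : ℝ} {u : Euc n → ℝ}
    (hp : 1 ≤ p) (hu : MemN Ω s p u) {x y : Euc n} (hx : x ∈ Ω) (hd : 0 < dB Ω x)
    (hxy : dist x y ≤ dB Ω x / 20) {σ : ℝ} (hσ0 : 0 ≤ σ) (hσb : σ ≤ sb)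
    (hσ : ∀ z ∈ PhiB Ω x, σ ≤ s z) (hd1 : dB Ω x ≤ 1 / 2) :
    |gFun Ω u x - gFun Ω u y| ^ p ≤
      ((2 * 4 ^ n) ^ p * 2 ^ (p * sb) * 6 ^ n / volume.real (ball (0 : Euc n) 1)) *
        dB Ω x ^ (p * σ - n) * nuM Ω s p u (PhiB Ω x) := by
  set K : ℝ := (2 * 4 ^ n) ^ p * 2 ^ (p * sb) with hK
  have hKpos : 0 < K := by positivity
  have hv := aux_vol_pos (n := n)
  have hp0 : 0 ≤ p := by linarith
  have key : ∀ z ∈ PhiB Ω x, |gFun Ω u x - gFun Ω u y| ^ p ≤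
      K * dB Ω x ^ (p * σ) * nuInt Ω s p u z := by
    intro z hz
    have hzd : dist z x < dB Ω x / 6 := hz
    have h1 := aux_dB_lip Ω z x
    have h2 := aux_dB_lip Ω x z
    rw [dist_comm x z] at h2
    have hdz : 0 < dB Ω z := by linarith
    have hnn := aux_nuInt_nonneg Ω s p u z
    calc |gFun Ω u x - gFun Ω u y| ^ p ≤ (2 * 4 ^ n * hFun Ω u z) ^ p := by
          gcongr
          exact aux_g_sub_g hn hu.1 hx hd hxy hz
      _ = (2 * 4 ^ n) ^ p * (nuInt Ω s p u z * dB Ω z ^ (p * s z)) := by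
          rw [Real.mul_rpow (by positivity) (aux_hFun_nonneg _ _ _), aux_hFun_pow s p u hdz]
      _ ≤ (2 * 4 ^ n) ^ p * (nuInt Ω s p u z * (2 ^ (p * sb) * dB Ω x ^ (p * σ))) := by
          gcongr
          calc dB Ω z ^ (p * s z) ≤ dB Ω z ^ (p * σ) := by
                apply Real.rpow_le_rpow_of_exponent_ge hdz (by linarith)
                have := hσ z hz
                gcongr
            _ ≤ (2 * dB Ω x) ^ (p * σ) := by
                gcongr
                linarith
            _ = 2 ^ (p * σ) * dB Ω x ^ (p * σ) := Real.mul_rpow (by norm_num) hd.le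
            _ ≤ 2 ^ (p * sb) * dB Ω x ^ (p * σ) := by
                gcongr
                norm_num
      _ = K * dB Ω x ^ (p * σ) * nuInt Ω s p u z := by rw [hK]; ring
  have hPhi : PhiB Ω x ⊆ Ω := (ball_subset_ball (by linarith)).trans (aux_ball_subset hx)
  have hvPhi : volume.real (PhiB Ω x) = (dB Ω x / 6) ^ n * volume.real (ball (0 : Euc n) 1) :=
    aux_vol_ball hn x (by linarith)
  have hfin : volume (PhiB Ω x) ≠ ∞ := measure_ball_lt_top.ne
  have hint : volume.real (PhiB Ω x) * |gFun Ω u x - gFun Ω u y| ^ p ≤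
      K * dB Ω x ^ (p * σ) * nuM Ω s p u (PhiB Ω x) := by
    have := setIntegral_mono_on (integrableOn_const (μ := volume)
      (C := |gFun Ω u x - gFun Ω u y| ^ p) hfin)
      ((hu.2.mono_set hPhi).const_mul (K * dB Ω x ^ (p * σ))) measurableSet_ball key
    rw [integral_const_mul] at this
    simp only [integral_const, smul_eq_mul, measureReal_restrict_apply_univ] at this
    unfold nuM
    rwa [inter_eq_self_of_subset_right hPhi]
  rw [hvPhi] at hint
  rw [Real.rpow_sub hd, Real.rpow_natCast]
  rw [div_pow] at hint
  have h6 : (0:ℝ) < 6 ^ n := by positivity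
  have hdn : 0 < dB Ω x ^ n := by positivity
  rw [show K * 6 ^ n / volume.real (ball (0 : Euc n) 1) * (dB Ω x ^ (p * σ) / dB Ω x ^ n) *
    nuM Ω s p u (PhiB Ω x) = (K * dB Ω x ^ (p * σ) * nuM Ω s p u (PhiB Ω x)) /
      (dB Ω x ^ n / 6 ^ n * volume.real (ball (0 : Euc n) 1)) by field_simp]
  rw [le_div_iff₀ (by positivity)]
  linarith

/-- Chaining along a rectifiable path. -/
lemma aux_chain {E : Type*} [PseudoMetricSpace E] {γ : ℝ → E} (hγ : ContinuousOn γ (Icc 0 1))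
    {f : E → ℝ} {d : E → ℝ} {c m D B : ℝ} (hc : 0 < c) (hm : 0 < m) (hB : 0 ≤ B)
    (hd : ∀ τ ∈ Icc (0:ℝ) 1, m ≤ d (γ τ) ∧ d (γ τ) ≤ D)
    (hf : ∀ τ ∈ Icc (0:ℝ) 1, ∀ τ' ∈ Icc (0:ℝ) 1, dist (γ τ) (γ τ') ≤ c * d (γ τ) →
      |f (γ τ) - f (γ τ')| ≤ B * d (γ τ))
    (N : ℕ) : ∀ a ∈ Icc (0:ℝ) 1, ∀ L : ℝ, 0 ≤ L → L ≤ N * (c * m) →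
      eVariationOn γ (Icc a 1) ≤ ENNReal.ofReal L →
      |f (γ a) - f (γ 1)| ≤ B / c * L + B * D := by
  have h1 : (1:ℝ) ∈ Icc (0:ℝ) 1 := ⟨zero_le_one, le_rfl⟩
  have hdirect : ∀ a ∈ Icc (0:ℝ) 1, ∀ L : ℝ, 0 ≤ L → dist (γ a) (γ 1) ≤ c * d (γ a) →
      |f (γ a) - f (γ 1)| ≤ B / c * L + B * D := by
    intro a ha L hL h
    have := hf a ha 1 h1 h
    have h2 : B * d (γ a) ≤ B * D := mul_le_mul_of_nonneg_left (hd a ha).2 hB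
    have h3 : 0 ≤ B / c * L := by positivity
    linarith
  have hdist : ∀ a b : ℝ, a ≤ b → ∀ L : ℝ, 0 ≤ L → eVariationOn γ (Icc a b) ≤ ENNReal.ofReal L →
      dist (γ a) (γ b) ≤ L := by
    intro a b hab L hL h
    have := (eVariationOn.edist_le γ (left_mem_Icc.2 hab) (right_mem_Icc.2 hab)).trans h
    rw [edist_dist] at this
    exact (ENNReal.ofReal_le_ofReal_iff hL).1 this
  induction N with
  | zero =>
    intro a ha L hL hLN hV
    have := hdist a 1 ha.2 L hL hV
    refine hdirect a ha L hL ?_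
    have h4 := (hd a ha).1
    have : 0 ≤ c * d (γ a) := by have : 0 ≤ d (γ a) := by linarith
                                 positivity
    simp at hLN
    linarith
  | succ N ih =>
    intro a ha L hL hLN hV
    by_cases hcase : dist (γ a) (γ 1) ≤ c * d (γ a)
    · exact hdirect a ha L hL hcase
    · push Not at hcase
      have hda := (hd a ha).1
      have hpos : 0 ≤ c * d (γ a) := by have : 0 ≤ d (γ a) := by linarith
                                        positivity
      have hcont : ContinuousOn (fun τ => dist (γ a) (γ τ)) (Icc a 1) :=
        fun w hw => Filter.Tendsto.dist tendsto_const_nhds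
          ((hγ.mono (Icc_subset_Icc_left ha.1)) w hw)
      have hmem : c * d (γ a) ∈ Icc (dist (γ a) (γ a)) (dist (γ a) (γ 1)) :=
        ⟨by rw [dist_self]; exact hpos, hcase.le⟩
      obtain ⟨τ, hτ, hτe⟩ := intermediate_value_Icc ha.2 hcont hmem
      have hτe' : dist (γ a) (γ τ) = c * d (γ a) := hτe
      have hτ01 : τ ∈ Icc (0:ℝ) 1 := ⟨ha.1.trans hτ.1, hτ.2⟩
      have hsum := eVariationOn.Icc_add_Icc γ (s := univ) hτ.1 hτ.2 (mem_univ τ)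
      simp only [univ_inter] at hsum
      have hV1 : ENNReal.ofReal (c * d (γ a)) ≤ eVariationOn γ (Icc a τ) := by
        rw [← hτe', ← edist_dist]
        exact eVariationOn.edist_le γ (left_mem_Icc.2 hτ.1) (right_mem_Icc.2 hτ.1)
      have hV2 : ENNReal.ofReal (c * d (γ a)) + eVariationOn γ (Icc τ 1) ≤ ENNReal.ofReal L :=
        (add_le_add_left hV1 _).trans (hsum.le.trans hV)
      have hcL : c * d (γ a) ≤ L := by
        have := (le_self_add).trans hV2
        exact (ENNReal.ofReal_le_ofReal_iff hL).1 this
      have hV3 : eVariationOn γ (Icc τ 1) ≤ ENNReal.ofReal (L - c * d (γ a)) := by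
        rw [ENNReal.ofReal_sub _ hpos]
        exact ENNReal.le_sub_of_add_le_left ENNReal.ofReal_ne_top hV2
      have h5 := ih τ hτ01 (L - c * d (γ a)) (by linarith) (by
        push_cast at hLN
        have : c * m ≤ c * d (γ a) := by gcongr
        linarith) hV3
      have h6 := hf a ha τ hτ01 hτe'.le
      have h7 := abs_sub_le (f (γ a)) (f (γ τ)) (f (γ 1))
      have h8 : B / c * (L - c * d (γ a)) = B / c * L - B * d (γ a) := by
        field_simp
      linarith


lemma aux_alpha {p σ θ ω : ℝ} (hθ : 1 ≤ θ)
    (h : 0 ≤ alphaFun n p σ θ + ω) :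
    -ω ≤ p * σ - n ∧ -ω - p ≤ θ * (p * σ - n - p) := by
  unfold alphaFun at h
  split_ifs at h with hc
  · constructor
    · nlinarith [mul_nonneg (sub_nonneg.2 hθ) (by linarith : 0 ≤ p - (p * σ - n))]
    · nlinarith
  · push Not at hc
    constructor
    · linarith
    · nlinarith [mul_nonneg (sub_nonneg.2 hθ) (by linarith : 0 ≤ (p * σ - n) - (p - 1))]

lemma aux_d_pow {p σ θ ω sb R e Λ d : ℝ} (hp : 1 ≤ p) (hσ0 : 0 ≤ σ) (hσb : σ ≤ sb)
    (hθ : 1 ≤ θ) (h : 0 ≤ alphaFun n p σ θ + ω) (hR : 0 < R) (hR1 : R ≤ 1) (he : 0 < e)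
    (he1 : e ≤ 1) (hΛ : 1 ≤ Λ) (hd1 : e * R ^ θ ≤ d) (hd2 : d ≤ Λ * R) :
    d ^ (p * σ - n - p) ≤ (e ^ (-(n + p)) + Λ ^ (p * sb)) * R ^ (-ω - p) := by
  obtain ⟨h1, h2⟩ := aux_alpha hθ h
  have hp0 : 0 ≤ p := by linarith
  have hn0 : (0:ℝ) ≤ n := Nat.cast_nonneg n
  have hσp : 0 ≤ p * σ := by positivity
  have hdpos : 0 < d := lt_of_lt_of_le (by positivity) hd1
  have hRw : 0 < R ^ (-ω - p) := by positivity
  have ha : 0 < e ^ (-(n + p)) := by positivity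
  have hb : 0 < Λ ^ (p * sb) := by positivity
  rw [add_mul]
  rcases le_total (p * σ - n - p) 0 with hβ | hβ
  · have : d ^ (p * σ - n - p) ≤ e ^ (-(n + p)) * R ^ (-ω - p) := by
      calc d ^ (p * σ - n - p) ≤ (e * R ^ θ) ^ (p * σ - n - p) :=
            Real.rpow_le_rpow_of_nonpos (by positivity) hd1 hβ
        _ = e ^ (p * σ - n - p) * R ^ (θ * (p * σ - n - p)) := by
            rw [Real.mul_rpow he.le (by positivity), ← Real.rpow_mul hR.le]
        _ ≤ e ^ (-(n + p)) * R ^ (-ω - p) := by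
            gcongr ?_ * ?_
            · exact Real.rpow_le_rpow_of_exponent_ge he he1 (by linarith)
            · exact Real.rpow_le_rpow_of_exponent_ge hR hR1 h2
    have : 0 < Λ ^ (p * sb) * R ^ (-ω - p) := by positivity
    linarith
  · have : d ^ (p * σ - n - p) ≤ Λ ^ (p * sb) * R ^ (-ω - p) := by
      calc d ^ (p * σ - n - p) ≤ (Λ * R) ^ (p * σ - n - p) := by gcongr
        _ = Λ ^ (p * σ - n - p) * R ^ (p * σ - n - p) := by
            rw [Real.mul_rpow (by linarith) hR.le]
        _ ≤ Λ ^ (p * sb) * R ^ (-ω - p) := by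
            gcongr ?_ * ?_
            · apply Real.rpow_le_rpow_of_exponent_le hΛ
              have : p * σ ≤ p * sb := by gcongr
              linarith
            · exact Real.rpow_le_rpow_of_exponent_ge hR hR1 (by linarith)
    have : 0 < e ^ (-(n + p)) * R ^ (-ω - p) := by positivity
    linarith

lemma aux_sLow_le {Ω : Set (Euc n)} {s : Euc n → ℝ} (hs0 : ∀ x, 0 ≤ s x) {zb z : Euc n} {δ : ℝ}
    (hz : z ∈ Ω) (hzb : dist z zb < δ) : sLow Ω s zb δ ≤ s z :=
  csInf_le ⟨0, by rintro _ ⟨w, -, rfl⟩; exact hs0 w⟩ ⟨z, ⟨hz, hzb⟩, rfl⟩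

lemma aux_sLow_nonneg {Ω : Set (Euc n)} {s : Euc n → ℝ} (hs0 : ∀ x, 0 ≤ s x) (zb : Euc n) (δ : ℝ) :
    0 ≤ sLow Ω s zb δ :=
  Real.sInf_nonneg (by rintro _ ⟨w, -, rfl⟩; exact hs0 w)

/-- Comparison of means at two points joined by a path. -/
lemma aux_link (hn : 1 ≤ n) {Ω : Set (Euc n)} (hΩo : IsOpen Ω) (hfr : (frontier Ω).Nonempty)
    {s : Euc n → ℝ} {p sb : ℝ} {u : Euc n → ℝ}
    (hp : 1 ≤ p) (hs0 : ∀ x, 0 ≤ s x) (hsb : ∀ x, s x ≤ sb) (hu : MemN Ω s p u)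
    {CΓ δΓ δ' θ ω lam : ℝ} (hCΓ : 1 ≤ CΓ) (hδΓ0 : 0 < δΓ) (hθ : 1 ≤ θ) {ε : ℝ → ℝ}
    (hlam : 0 < lam) (hlam1 : lam < 1) {zb : Euc n} (hzb : zb ∈ frontier Ω)
    (hconn : ConnectedTo Ω (Ω ∩ ball zb δΓ) zb CΓ θ (δΓ / (3 * CΓ)) ε)
    (hα : 0 ≤ alphaFun n p (sLow Ω s zb δ') θ + ω)
    {R : ℝ} (hR : 0 < R) (hR1 : R ≤ δΓ / (3 * CΓ)) (hR2 : 2 * (1 + CΓ) * R ≤ δ')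
    (hR3 : (1 + CΓ) * R ≤ 1 / 2) {a b : Euc n} (ha : a ∈ Ω) (hb : b ∈ Ω)
    (had : dist a zb < R) (hbd : dist b zb < R) (hda : (lam * R) ^ θ ≤ dB Ω a)
    (hdb : (lam * R) ^ θ ≤ dB Ω b) :
    |gFun Ω u a - gFun Ω u b| ^ p ≤
      (((2 * 4 ^ n) ^ p * 2 ^ (p * sb) * 6 ^ n / volume.real (ball (0 : Euc n) 1)) *
        (ε lam ^ (-(n + p)) + (1 + CΓ) ^ (p * sb)) * (20 * CΓ + (1 + CΓ)) ^ p) *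
      R ^ (-ω) * nuM Ω s p u (ball zb (2 * (1 + CΓ) * R)) := by
  have hv := aux_vol_pos (n := n)
  set K : ℝ := (2 * 4 ^ n) ^ p * 2 ^ (p * sb) * 6 ^ n / volume.real (ball (0 : Euc n) 1) with hK
  have hKpos : 0 < K := by positivity
  obtain ⟨he, he1, hc⟩ := hconn lam hlam hlam1
  set e := ε lam
  set Cd : ℝ := e ^ (-(n + p)) + (1 + CΓ) ^ (p * sb) with hCd
  have hCdpos : 0 < Cd := by positivity
  set σ := sLow Ω s zb δ' with hσdef
  have hσ0 : 0 ≤ σ := aux_sLow_nonneg hs0 zb δ'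
  have hRδ : R ≤ δΓ := by
    have : δΓ / (3 * CΓ) ≤ δΓ := div_le_self hδΓ0.le (by linarith)
    linarith
  have hR'1 : R ≤ 1 := by nlinarith
  have hpp : 0 < p := by linarith
  have hCR : R ≤ CΓ * R := by nlinarith
  have hσb : σ ≤ sb := by
    refine (aux_sLow_le hs0 ha (had.trans_le ?_)).trans (hsb a)
    linarith
  obtain ⟨γ, hγc, hγ0, hγ1, hγ, hγv⟩ := hc R hR hR1 a ⟨⟨ha, had.trans_le hRδ⟩, had⟩ b
    ⟨⟨hb, hbd.trans_le hRδ⟩, hbd⟩ hda hdb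
  set Nn := nuM Ω s p u (ball zb (2 * (1 + CΓ) * R)) with hNn
  have hNn0 : 0 ≤ Nn := aux_nuM_nonneg _
  have hloc : ∀ τ ∈ Icc (0:ℝ) 1, dist (γ τ) zb < (1 + CΓ) * R := by
    intro τ hτ
    have h1 := (eVariationOn.edist_le γ hτ (left_mem_Icc.2 zero_le_one)).trans hγv
    rw [edist_dist, ENNReal.ofReal_le_ofReal_iff (by positivity), hγ0] at h1
    have := dist_triangle (γ τ) a zb
    linarith
  have hDle : ∀ τ ∈ Icc (0:ℝ) 1, dB Ω (γ τ) ≤ (1 + CΓ) * R := fun τ hτ =>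
    (infDist_le_dist_of_mem hzb).trans (hloc τ hτ).le
  set W : ℝ := K * Cd * R ^ (-ω - p) * Nn with hW
  have hW0 : 0 ≤ W := by positivity
  have hRθ : 0 < R ^ θ := by positivity
  have hchain := aux_chain (f := gFun Ω u) (d := dB Ω) (c := 1 / 20) (m := e * R ^ θ)
    (D := (1 + CΓ) * R) (B := W ^ (1 / p)) hγc (by norm_num) (by positivity) (by positivity)
    (fun τ hτ => ⟨(hγ τ hτ).2, hDle τ hτ⟩) (by
      intro τ hτ τ' hτ' hdist
      have hτΩ := (hγ τ hτ).1.1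
      have hdpos := aux_dB_pos hΩo hfr hτΩ
      have hD := hDle τ hτ
      have hΦ : PhiB Ω (γ τ) ⊆ ball zb (2 * (1 + CΓ) * R) := by
        apply ball_subset_ball'
        have := hloc τ hτ
        linarith
      have h1 := aux_local (y := γ τ') (σ := σ) hn hp hu hτΩ hdpos (by linarith) hσ0 hσb (by
        intro z hz
        have hz1 : dist z (γ τ) < dB Ω (γ τ) / 6 := hz
        exact aux_sLow_le hs0 (aux_ball_subset hτΩ (by rw [mem_ball]; linarith))
          ((mem_ball.1 (hΦ hz)).trans_le hR2)) (by linarith)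
      rw [← hK] at h1
      have h2 := aux_d_pow (sb := sb) (Λ := 1 + CΓ) hp hσ0 hσb hθ hα hR hR'1 he
        (by linarith) (by linarith) (hγ τ hτ).2 hD
      rw [← hCd] at h2
      have h3 : nuM Ω s p u (PhiB Ω (γ τ)) ≤ Nn := aux_nuM_mono hu hΦ
      have h4 : |gFun Ω u (γ τ) - gFun Ω u (γ τ')| ^ p ≤ (W ^ (1 / p) * dB Ω (γ τ)) ^ p := by
        rw [Real.mul_rpow (by positivity) hdpos.le, ← Real.rpow_mul hW0,
          one_div_mul_cancel hpp.ne', Real.rpow_one]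
        calc _ ≤ _ := h1
          _ = K * (dB Ω (γ τ) ^ p * dB Ω (γ τ) ^ (p * σ - n - p)) *
              nuM Ω s p u (PhiB Ω (γ τ)) := by
              rw [← Real.rpow_add hdpos]
              congr 3
              ring
          _ ≤ K * (dB Ω (γ τ) ^ p * (Cd * R ^ (-ω - p))) * Nn := by
              gcongr
              exact aux_nuM_nonneg _
          _ = W * dB Ω (γ τ) ^ p := by rw [hW]; ring
      exact (Real.rpow_le_rpow_iff (abs_nonneg _) (by positivity) hpp).1 h4)
  obtain ⟨N, hN⟩ := exists_nat_ge (CΓ * R / (1 / 20 * (e * R ^ θ)))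
  rw [div_le_iff₀ (by positivity)] at hN
  have hfin := hchain N 0 ⟨le_rfl, zero_le_one⟩ (CΓ * R) (by positivity) hN hγv
  rw [hγ0, hγ1] at hfin
  have hfin2 : |gFun Ω u a - gFun Ω u b| ≤ W ^ (1 / p) * R * (20 * CΓ + (1 + CΓ)) := by
    refine hfin.trans_eq ?_
    ring
  calc |gFun Ω u a - gFun Ω u b| ^ p ≤ (W ^ (1 / p) * R * (20 * CΓ + (1 + CΓ))) ^ p := by gcongr
    _ = W * R ^ p * (20 * CΓ + (1 + CΓ)) ^ p := by
        rw [Real.mul_rpow (by positivity) (by positivity), Real.mul_rpow (by positivity) hR.le,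
          ← Real.rpow_mul hW0, one_div_mul_cancel hpp.ne', Real.rpow_one]
    _ = K * Cd * (20 * CΓ + (1 + CΓ)) ^ p * (R ^ (-ω - p) * R ^ p) * Nn := by rw [hW]; ring
    _ = _ := by
        rw [← Real.rpow_add hR]
        congr 3
        ring


/-- Pointwise telescoping estimate through the dyadic scales at the nearest boundary point. -/
lemma aux_pointwise {Ω : Set (Euc n)} (hΩo : IsOpen Ω) (hfr : (frontier Ω).Nonempty)
    {f : Euc n → ℝ} {Nn : Set (Euc n) → ℝ} (hNmono : ∀ E F, E ⊆ F → Nn E ≤ Nn F)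
    {θ : Euc n → ℝ} (hθ : ∀ z, 1 ≤ θ z) {p η ω Λ C R₁ ρ' : ℝ} (hp : 1 ≤ p) (hη : 0 < η) (hη1 : η < 1)
    (hC : 0 < C) {x₀ : Euc n} (hx₀ : x₀ ∈ frontier Ω)
    (hcork : ∀ zb ∈ frontier Ω ∩ ball x₀ ρ', ∀ δ : ℝ, 0 < δ → δ ≤ R₁ →
      ∃ y ∈ Ω, dist y zb < δ ∧ (η * δ) ^ θ zb < dB Ω y)
    (hlink : ∀ zb ∈ frontier Ω ∩ ball x₀ ρ', ∀ R : ℝ, 0 < R → R ≤ R₁ → ∀ a ∈ Ω, ∀ b ∈ Ω,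
      dist a zb < R → dist b zb < R → (η / 8 * R) ^ θ zb ≤ dB Ω a → (η / 8 * R) ^ θ zb ≤ dB Ω b →
      |f a - f b| ^ p ≤ C * R ^ (-ω) * Nn (ball zb (Λ * R)))
    {ρ : ℝ} (hρ : 0 < ρ) (hρ1 : 8 * ρ ≤ R₁) (hρ2 : 2 * ρ ≤ ρ') (hρ3 : 8 * ρ ≤ 1)
    {xρ x : Euc n} (hxρ : xρ ∈ Ω) (hxρd : dist xρ x₀ < ρ) (hxρθ : (η * ρ) ^ θ x₀ < dB Ω xρ)
    (hx : x ∈ Ω) (hxd : dist x x₀ < ρ) {q T : ℝ} (hq : 0 < q) (hq1 : q < 1) (hT : 0 ≤ T)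
    (hTk : ∀ k : ℕ, (8 * ρ / 2 ^ k) ^ (-ω) * Nn (ball x ((Λ + 1) * (8 * ρ / 2 ^ k))) ≤ T * q ^ k) :
    |f xρ - f x| ^ p ≤ C * (1 / (1 - q ^ (1 / p))) ^ p * T := by
  have hpp : 0 < p := by linarith
  set R : ℕ → ℝ := fun k => 8 * ρ / 2 ^ k with hRdef
  have hRpos : ∀ k, 0 < R k := fun k => by positivity
  have hRle : ∀ k, R k ≤ 8 * ρ := fun k =>
    div_le_self (by positivity) (one_le_pow₀ (by norm_num))
  have hRs : ∀ k, R (k + 1) = R k / 2 := fun k => by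
    simp only [hRdef, pow_succ]
    field_simp
  have hR0 : R 0 = 8 * ρ := by simp [hRdef]
  have hr := aux_dB_pos hΩo hfr hx
  obtain ⟨xb, hxbfr, hxbd⟩ := isClosed_frontier.exists_infDist_eq_dist hfr x
  change dB Ω x = dist x xb at hxbd
  have hrρ : dB Ω x < ρ := (infDist_le_dist_of_mem hx₀).trans_lt hxd
  have hxb0 : dist xb x₀ < 2 * ρ := by
    have := dist_triangle xb x x₀
    rw [dist_comm xb x] at this
    linarith
  have hxb : xb ∈ frontier Ω ∩ ball x₀ ρ' := ⟨hxbfr, hxb0.trans_le hρ2⟩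
  have hx₀' : x₀ ∈ frontier Ω ∩ ball x₀ ρ' := ⟨hx₀, mem_ball_self (by linarith)⟩
  -- the scale matching `d(x)`
  obtain ⟨K, hK1, hK2⟩ : ∃ K : ℕ, dB Ω x < R K ∧ R K ≤ 2 * dB Ω x := by
    obtain ⟨K, h1, h2⟩ := exists_nat_pow_near_of_lt_one (x := dB Ω x / (8 * ρ)) (y := 1 / 2)
      (by positivity) (by rw [div_le_one (by positivity)]; linarith) (by norm_num) (by norm_num)
    rw [lt_div_iff₀ (by positivity)] at h1
    rw [div_le_iff₀ (by positivity)] at h2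
    have e1 : (1 / 2 : ℝ) ^ K * (8 * ρ) = R K := by simp only [hRdef, one_div, inv_pow]; ring
    have e2 : (1 / 2 : ℝ) ^ (K + 1) * (8 * ρ) = R (K + 1) := by
      simp only [hRdef, one_div, inv_pow]; ring
    rw [e1] at h2
    rw [e2] at h1
    rcases h2.lt_or_eq with h | h
    · exact ⟨K, h, by rw [hRs] at h1; linarith⟩
    · refine ⟨K - 1, ?_, ?_⟩
      · rcases K with _ | K
        · rw [hR0] at h; linarith
        · rw [hRs] at h
          simp only [Nat.add_sub_cancel]
          linarith
      · rcases K with _ | K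
        · rw [hR0] at h; linarith
        · rw [hRs] at h
          simp only [Nat.add_sub_cancel]
          linarith
  have hK0 : 1 ≤ K := by
    by_contra h
    have : K = 0 := by omega
    rw [this, hR0] at hK2
    linarith
  choose Y hYΩ hYd hYθ using fun k => hcork xb hxb (R k) (hRpos k) ((hRle k).trans hρ1)
  set y : ℕ → Euc n := fun k => if k = 0 then xρ else if k ≤ K then Y k else x with hy
  have hRanti : ∀ k ≤ K, R K ≤ R k := fun k hk => by
    simp only [hRdef]
    gcongr
    norm_num
  have hηR : ∀ k, 0 < η / 8 * R k := fun k => mul_pos (by positivity) (hRpos k)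
  have hθ0 : ∀ z, 0 ≤ θ z := fun z => by linarith [hθ z]
  -- each link
  have hstep : ∀ k, |f (y k) - f (y (k + 1))| ^ p ≤ C * (T * q ^ k) := by
    intro k
    have hgen : ∀ zb ∈ frontier Ω ∩ ball x₀ ρ', dist zb x ≤ R k → ∀ a ∈ Ω, ∀ b ∈ Ω,
        dist a zb < R k → dist b zb < R k → (η / 8 * R k) ^ θ zb ≤ dB Ω a →
        (η / 8 * R k) ^ θ zb ≤ dB Ω b → |f a - f b| ^ p ≤ C * (T * q ^ k) := by
      intro zb hzb hzx a ha b hb h1 h2 h3 h4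
      refine (hlink zb hzb (R k) (hRpos k) ((hRle k).trans hρ1) a ha b hb h1 h2 h3 h4).trans ?_
      rw [mul_assoc]
      refine mul_le_mul_of_nonneg_left (le_trans ?_ (hTk k)) hC.le
      refine mul_le_mul_of_nonneg_left (hNmono _ _ (ball_subset_ball' ?_))
        (Real.rpow_nonneg (hRpos k).le _)
      change Λ * R k + dist zb x ≤ (Λ + 1) * R k
      linarith
    rcases Nat.eq_zero_or_pos k with rfl | hk
    · have e0 : y 0 = xρ := by simp [hy]
      have e1 : y (0 + 1) = Y 1 := by simp [hy, hK0]
      rw [e0, e1]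
      have hR1 : R 1 = 4 * ρ := by simp only [hRdef]; ring
      have hY1d : dist (Y 1) xb < 4 * ρ := hR1 ▸ hYd 1
      have hY1θ : (η * (4 * ρ)) ^ θ xb < dB Ω (Y 1) := hR1 ▸ hYθ 1
      have e8 : η / 8 * R 0 = η * ρ := by rw [hR0]; ring
      rcases le_total (θ x₀) (θ xb) with hle | hle
      · refine hgen xb hxb ?_ xρ hxρ (Y 1) (hYΩ 1) ?_ ?_ ?_ ?_
        · rw [dist_comm, ← hxbd, hR0]; linarith
        · have := dist_triangle xρ x₀ xb
          rw [dist_comm x₀ xb] at this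
          rw [hR0]; linarith
        · rw [hR0]; linarith
        · rw [e8]
          refine le_trans ?_ hxρθ.le
          exact Real.rpow_le_rpow_of_exponent_ge (by positivity) (by nlinarith) hle
        · rw [e8]
          refine le_trans ?_ hY1θ.le
          exact Real.rpow_le_rpow (by positivity) (by nlinarith [mul_pos hη hρ]) (hθ0 _)
      · refine hgen x₀ hx₀' ?_ xρ hxρ (Y 1) (hYΩ 1) ?_ ?_ ?_ ?_
        · rw [dist_comm, hR0]; linarith
        · rw [hR0]; linarith
        · have := dist_triangle (Y 1) xb x₀
          rw [hR0]; linarith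
        · rw [e8]
          exact hxρθ.le
        · rw [e8]
          refine le_trans ?_ hY1θ.le
          refine le_trans (Real.rpow_le_rpow_of_exponent_ge (by positivity) (by nlinarith) hle) ?_
          exact Real.rpow_le_rpow (by positivity) (by nlinarith [mul_pos hη hρ]) (hθ0 _)
    · have hk0 : k ≠ 0 := by omega
      have hYk : (η / 8 * R k) ^ θ xb ≤ dB Ω (Y k) := by
        refine le_trans ?_ (hYθ k).le
        exact Real.rpow_le_rpow (hηR k).le (by nlinarith [mul_pos hη (hRpos k)]) (hθ0 _)
      rcases lt_trichotomy k K with hkK | hkK | hkK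
      · have e0 : y k = Y k := by simp [hy, hk0, hkK.le]
        have e1 : y (k + 1) = Y (k + 1) := by
          simp only [hy, Nat.add_eq_zero_iff, one_ne_zero, and_false, if_false]
          rw [if_pos (by omega)]
        rw [e0, e1]
        have h1 := hRpos k
        refine hgen xb hxb ?_ _ (hYΩ k) _ (hYΩ (k + 1)) (hYd k) ?_ hYk ?_
        · rw [dist_comm, ← hxbd]
          have := hRanti k hkK.le
          linarith
        · have := hYd (k + 1)
          rw [hRs] at this
          linarith
        · refine le_trans ?_ (hYθ (k + 1)).le
          refine Real.rpow_le_rpow (hηR k).le ?_ (hθ0 _)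
          rw [hRs]
          nlinarith [mul_pos hη (hRpos k)]
      · subst hkK
        have e0 : y k = Y k := by simp [hy, hk0]
        have e1 : y (k + 1) = x := by simp [hy]
        rw [e0, e1]
        refine hgen xb hxb ?_ _ (hYΩ k) x hx (hYd k) ?_ hYk ?_
        · rw [dist_comm, ← hxbd]; exact hK1.le
        · rw [← hxbd]; exact hK1
        · have h1 : η / 8 * R k ≤ 1 := by
            have := hRle k
            have := hRpos k
            nlinarith
          calc (η / 8 * R k) ^ θ xb ≤ (η / 8 * R k) ^ (1:ℝ) :=
                Real.rpow_le_rpow_of_exponent_ge (hηR k) h1 (hθ _)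
            _ = η / 8 * R k := Real.rpow_one _
            _ ≤ dB Ω x := by
                have := hRpos k
                nlinarith
      · have e0 : y k = x := by
          simp only [hy]
          rw [if_neg hk0, if_neg (by omega)]
        have e1 : y (k + 1) = x := by
          simp only [hy]
          rw [if_neg (by omega), if_neg (by omega)]
        rw [e0, e1, sub_self, abs_zero, Real.zero_rpow hpp.ne']
        positivity
  set q' := q ^ (1 / p) with hq'
  have hq'1 : q' < 1 := Real.rpow_lt_one hq.le hq1 (by positivity)
  have hq'0 : 0 < q' := by positivity
  have hq'p : q' ^ p = q := by
    rw [hq', ← Real.rpow_mul hq.le, one_div_mul_cancel hpp.ne', Real.rpow_one]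
  have hCT : 0 ≤ C * T := by positivity
  have hCTp : ((C * T) ^ (1 / p)) ^ p = C * T := by
    rw [← Real.rpow_mul hCT, one_div_mul_cancel hpp.ne', Real.rpow_one]
  have hdist : ∀ k, dist (f (y k)) (f (y (k + 1))) ≤ (C * T) ^ (1 / p) * q' ^ k := by
    intro k
    rw [Real.dist_eq]
    refine (Real.rpow_le_rpow_iff (abs_nonneg _) (by positivity) hpp).1 ?_
    rw [Real.mul_rpow (by positivity) (by positivity), hCTp, ← Real.rpow_natCast q' k,
      ← Real.rpow_mul hq'0.le, mul_comm (k:ℝ) p, Real.rpow_mul hq'0.le, hq'p, Real.rpow_natCast,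
      mul_assoc]
    exact hstep k
  have htend : Tendsto (fun k => f (y k)) atTop (𝓝 (f x)) := by
    refine tendsto_const_nhds.congr' ?_
    filter_upwards [eventually_gt_atTop K] with k hk
    simp only [hy]
    rw [if_neg (by omega), if_neg (by omega)]
  have := dist_le_of_le_geometric_of_tendsto₀ q' _ hq'1 hdist htend
  have e0 : y 0 = xρ := by simp [hy]
  simp only [e0] at this
  rw [Real.dist_eq] at this
  have h1q : 0 < 1 - q' := by linarith
  calc |f xρ - f x| ^ p ≤ ((C * T) ^ (1 / p) / (1 - q')) ^ p := by gcongr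
    _ = ((C * T) ^ (1 / p) * (1 / (1 - q'))) ^ p := by rw [mul_one_div]
    _ = C * (1 / (1 - q')) ^ p * T := by
      rw [Real.mul_rpow (by positivity) (by positivity), hCTp]
      ring


def nuMeas (Ω : Set (Euc n)) (s : Euc n → ℝ) (p : ℝ) (u : Euc n → ℝ) : Measure (Euc n) :=
  (volume.restrict Ω).withDensity (fun x => ENNReal.ofReal (nuInt Ω s p u x))

lemma aux_nuMeas_finite {Ω : Set (Euc n)} {s : Euc n → ℝ} {p : ℝ} {u : Euc n → ℝ}
    (hu : MemN Ω s p u) : IsFiniteMeasure (nuMeas Ω s p u) :=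
  isFiniteMeasure_withDensity_ofReal hu.2.2

lemma aux_nuMeas_ball {Ω : Set (Euc n)} {s : Euc n → ℝ} {p : ℝ} {u : Euc n → ℝ}
    (hu : MemN Ω s p u) (x : Euc n) (r : ℝ) :
    nuMeas Ω s p u (ball x r) = ENNReal.ofReal (nuM Ω s p u (ball x r)) := by
  unfold nuMeas nuM
  rw [withDensity_apply _ measurableSet_ball, Measure.restrict_restrict measurableSet_ball,
    inter_comm, ofReal_integral_eq_lintegral_ofReal (hu.2.mono_set inter_subset_left)
      (ae_of_all _ fun x => aux_nuInt_nonneg Ω s p u x)]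

lemma aux_tonelli (ν : Measure (Euc n)) [IsFiniteMeasure ν] (x₀ : Euc n) (ρ c : ℝ) :
    ∫⁻ x in ball x₀ ρ, ν (ball x c) ≤ volume (ball (0 : Euc n) c) * ν (ball x₀ (ρ + c)) := by
  set ν' := ν.restrict (ball x₀ (ρ + c)) with hν'
  have hS : MeasurableSet {z : Euc n × Euc n | dist z.1 z.2 < c} :=
    measurableSet_lt (by fun_prop) measurable_const
  have e1 : ∀ x : Euc n, Prod.mk x ⁻¹' {z : Euc n × Euc n | dist z.1 z.2 < c} = ball x c := by
    intro x; ext y; simp [dist_comm]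
  have e2 : ∀ y : Euc n, (fun x => (x, y)) ⁻¹' {z : Euc n × Euc n | dist z.1 z.2 < c} =
      ball y c := by
    intro x; ext y; simp
  have h1 := Measure.prod_apply (μ := (volume : Measure (Euc n))) (ν := ν') hS
  have h2 := Measure.prod_apply_symm (μ := (volume : Measure (Euc n))) (ν := ν') hS
  simp only [e1] at h1
  simp only [e2] at h2
  calc ∫⁻ x in ball x₀ ρ, ν (ball x c) = ∫⁻ x in ball x₀ ρ, ν' (ball x c) := by
        refine setLIntegral_congr_fun measurableSet_ball fun x hx => ?_
        rw [hν', Measure.restrict_apply measurableSet_ball, inter_eq_self_of_subset_left]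
        apply ball_subset_ball'
        have := mem_ball.1 hx
        linarith
    _ ≤ ∫⁻ x, ν' (ball x c) := setLIntegral_le_lintegral _ _
    _ = ∫⁻ y, volume (ball y c) ∂ν' := by rw [← h1, h2]
    _ = ∫⁻ y, volume (ball (0 : Euc n) c) ∂ν' := by
        refine lintegral_congr fun y => ?_
        rw [Measure.addHaar_ball_center]
    _ = _ := by
        rw [lintegral_const, hν', Measure.restrict_apply_univ]

lemma aux_ball_meas (ν : Measure (Euc n)) [IsFiniteMeasure ν] (c : ℝ) :
    Measurable fun x => ν (ball x c) := by
  have hS : MeasurableSet {z : Euc n × Euc n | dist z.1 z.2 < c} :=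
    measurableSet_lt (by fun_prop) measurable_const
  have e1 : ∀ x : Euc n, Prod.mk x ⁻¹' {z : Euc n × Euc n | dist z.1 z.2 < c} = ball x c := by
    intro x; ext y; simp [dist_comm]
  have := measurable_measure_prodMk_left (ν := ν) hS
  simpa only [e1] using this

def SFun (ν : Measure (Euc n)) (ω Λ q ρ : ℝ) (x : Euc n) : ℝ≥0∞ :=
  ∑' k : ℕ, ENNReal.ofReal ((q ^ k)⁻¹ * (8 * ρ / 2 ^ k) ^ (-ω)) * ν (ball x (Λ * (8 * ρ / 2 ^ k)))

lemma aux_SFun_int (hn : 1 ≤ n) (ν : Measure (Euc n)) [IsFiniteMeasure ν] {ω Λ q ρ : ℝ}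
    (hΛ : 0 ≤ Λ) (hρ : 0 < ρ) (hq : 0 < q) (hq1 : q < 1) (hq2 : q ^ 2 * 2 ^ ((n:ℝ) - ω) = 1)
    (x₀ : Euc n) :
    ∫⁻ x in ball x₀ ρ, SFun ν ω Λ q ρ x ≤
      ENNReal.ofReal ((8 * ρ) ^ ((n:ℝ) - ω) * Λ ^ n * volume.real (ball (0 : Euc n) 1) / (1 - q)) *
        ν (ball x₀ ((1 + 8 * Λ) * ρ)) := by
  have hv := aux_vol_pos (n := n)
  unfold SFun
  rw [lintegral_tsum (fun k => ((aux_ball_meas ν _).const_mul _).aemeasurable)]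
  set A : ℝ := (8 * ρ) ^ ((n:ℝ) - ω) * Λ ^ n * volume.real (ball (0 : Euc n) 1) with hA
  have hA0 : 0 ≤ A := by positivity
  have hterm : ∀ k : ℕ, ∫⁻ x in ball x₀ ρ, ENNReal.ofReal ((q ^ k)⁻¹ * (8 * ρ / 2 ^ k) ^ (-ω)) *
      ν (ball x (Λ * (8 * ρ / 2 ^ k))) ≤
      ENNReal.ofReal (A * q ^ k) * ν (ball x₀ ((1 + 8 * Λ) * ρ)) := by
    intro k
    have hR : 0 < 8 * ρ / 2 ^ k := by positivity
    have hRle : 8 * ρ / 2 ^ k ≤ 8 * ρ :=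
      div_le_self (by positivity) (one_le_pow₀ (by norm_num))
    rw [lintegral_const_mul _ (aux_ball_meas ν _)]
    refine (mul_le_mul_right (aux_tonelli ν x₀ ρ _) _).trans ?_
    rw [← mul_assoc]
    have hsub : ball x₀ (ρ + Λ * (8 * ρ / 2 ^ k)) ⊆ ball x₀ ((1 + 8 * Λ) * ρ) := by
      apply ball_subset_ball
      have := mul_le_mul_of_nonneg_left hRle hΛ
      linarith
    refine mul_le_mul' (le_of_eq ?_) (measure_mono hsub)
    rw [← ofReal_measureReal (measure_ball_lt_top.ne), ← ENNReal.ofReal_mul (by positivity),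
      aux_vol_ball hn _ (by positivity)]
    congr 1
    have e1 : (8 * ρ / 2 ^ k) ^ (-ω) * (8 * ρ / 2 ^ k) ^ n =
        (8 * ρ) ^ ((n:ℝ) - ω) * (q ^ k) ^ 2 := by
      rw [← Real.rpow_natCast (8 * ρ / 2 ^ k) n, ← Real.rpow_add hR,
        show -ω + (n:ℝ) = (n:ℝ) - ω by ring, Real.div_rpow (by positivity) (by positivity)]
      have e2 : ((2:ℝ) ^ k) ^ ((n:ℝ) - ω) = ((2:ℝ) ^ ((n:ℝ) - ω)) ^ k := by
        rw [← Real.rpow_natCast, ← Real.rpow_mul (by norm_num), mul_comm, Real.rpow_mul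
          (by norm_num), Real.rpow_natCast]
      have e3 : (q ^ k) ^ 2 * ((2:ℝ) ^ ((n:ℝ) - ω)) ^ k = 1 := by
        rw [← pow_mul, mul_comm k 2, pow_mul, ← mul_pow, hq2, one_pow]
      have : (0:ℝ) < ((2:ℝ) ^ ((n:ℝ) - ω)) ^ k := by positivity
      rw [e2, div_eq_iff this.ne', mul_assoc, e3, mul_one]
    rw [mul_pow]
    calc (q ^ k)⁻¹ * (8 * ρ / 2 ^ k) ^ (-ω) * (Λ ^ n * (8 * ρ / 2 ^ k) ^ n *
          volume.real (ball (0 : Euc n) 1))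
        = (q ^ k)⁻¹ * ((8 * ρ / 2 ^ k) ^ (-ω) * (8 * ρ / 2 ^ k) ^ n) * Λ ^ n *
          volume.real (ball (0 : Euc n) 1) := by ring
      _ = A * q ^ k := by
        rw [e1, hA]
        field_simp
  refine (ENNReal.tsum_le_tsum hterm).trans ?_
  rw [ENNReal.tsum_mul_right, ← ENNReal.ofReal_tsum_of_nonneg (fun k => by positivity)
    ((summable_geometric_of_lt_one hq.le hq1).mul_left A), tsum_mul_left,
    tsum_geometric_of_lt_one hq.le hq1, ← div_eq_mul_inv]

lemma aux_three {p a b c : ℝ} (hp : 0 ≤ p) (ha : 0 ≤ a) (hb : 0 ≤ b) (hc : 0 ≤ c) :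
    (a + b + c) ^ p ≤ 3 ^ p * a ^ p + 3 ^ p * b ^ p + 3 ^ p * c ^ p := by
  have key : ∀ m : ℝ, 0 ≤ m → a ≤ m → b ≤ m → c ≤ m → (a + b + c) ^ p ≤ 3 ^ p * m ^ p := by
    intro m hm h1 h2 h3
    rw [← Real.mul_rpow (by norm_num) hm]
    exact Real.rpow_le_rpow (by positivity) (by linarith) hp
  have A : 0 ≤ 3 ^ p * a ^ p := by positivity
  have B : 0 ≤ 3 ^ p * b ^ p := by positivity
  have C : 0 ≤ 3 ^ p * c ^ p := by positivity
  rcases le_total a b with h1 | h1 <;> rcases le_total b c with h2 | h2 <;>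
    rcases le_total a c with h3 | h3
  all_goals first
    | (have := key a ha le_rfl (by linarith) (by linarith); linarith)
    | (have := key b hb (by linarith) le_rfl (by linarith); linarith)
    | (have := key c hc (by linarith) (by linarith) le_rfl; linarith)

lemma aux_vol_lower (hn : 1 ≤ n) {Ω : Set (Euc n)} {x₀ y : Euc n} {ρ η θ : ℝ} (hρ : 0 < ρ)
    (hρ1 : ρ ≤ 1) (hη : 0 < η) (hη1 : η < 1) (hθ : 1 ≤ θ) (hy : y ∈ Ω)
    (hyd : dist x₀ y < ρ / 2) (hyθ : (η * (ρ / 2)) ^ θ < dB Ω y) :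
    (η / 2) ^ (n * θ) * volume.real (ball (0 : Euc n) 1) * ρ ^ (n * θ) ≤
      volume.real (Ω ∩ ball x₀ ρ) := by
  set r := (η * (ρ / 2)) ^ θ with hr
  have hr0 : 0 < r := by positivity
  have hr1 : r ≤ ρ / 2 := by
    calc r ≤ (η * (ρ / 2)) ^ (1:ℝ) :=
          Real.rpow_le_rpow_of_exponent_ge (by positivity) (by nlinarith) hθ
      _ = η * (ρ / 2) := Real.rpow_one _
      _ ≤ ρ / 2 := by nlinarith
  have hsub : ball y r ⊆ Ω ∩ ball x₀ ρ := by
    refine subset_inter ((ball_subset_ball hyθ.le).trans (aux_ball_subset hy)) ?_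
    apply ball_subset_ball'
    rw [dist_comm]
    linarith
  have hfin : volume (Ω ∩ ball x₀ ρ) ≠ ∞ :=
    ((measure_mono inter_subset_right).trans_lt measure_ball_lt_top).ne
  refine le_trans (le_of_eq ?_) (measureReal_mono hsub hfin)
  rw [aux_vol_ball hn _ hr0.le, hr, ← Real.rpow_natCast, ← Real.rpow_mul (by positivity),
    show η * (ρ / 2) = η / 2 * ρ by ring, Real.mul_rpow (by positivity) hρ.le, mul_comm θ]
  ring

set_option maxHeartbeats 4000000 in
/-- Lebesgue point property of the trace at a point. Under (H1), (H2), (H4′)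
and (H4″), if `∂Ω ∩ B(xb₀,ρ′) ⊆ A_{ω,δ′} ∩ Γ_t` with `ω < t − n(θ_Γ(xb₀) − 1)`, then the means
of `|Tu(xb₀) − u|ᵖ` over `Ω ∩ B(xb₀,ρ)` vanish as `ρ → 0⁺`. -/
theorem statement16 (n : ℕ) (hn : 1 ≤ n) (p t AΓ CΓ δΓ : ℝ)
    (hp : 1 ≤ p) (ht : 0 ≤ t) (htn : t < n) (hAΓ : 1 ≤ AΓ) (hCΓ : 1 ≤ CΓ)
    (hδΓ0 : 0 < δΓ) (hδΓ1 : δΓ < 1)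
    (Ω : Set (Euc n)) (hΩo : IsOpen Ω) (hΩne : Ω.Nonempty) (hfr : (frontier Ω).Nonempty)
    (Γ : Set (Euc n)) (hΓfr : Γ ⊆ frontier Ω)
    (θΓ : Euc n → ℝ) (hθ1 : ∀ xb, 1 ≤ θΓ xb) (hθb : ∃ b : ℝ, ∀ xb, θΓ xb ≤ b)
    (s : Euc n → ℝ) (hsm : Measurable s) (hs0 : ∀ x, 0 ≤ s x) (hsb : ∃ b : ℝ, ∀ x, s x ≤ b)
    (lam₀ η₀ : ℝ) (hlam₀ : 0 < lam₀) (hlam₀1 : lam₀ < 1) (hη₀ : 0 < η₀) (hη₀1 : η₀ < 1)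
    (H1 : ∀ xb ∈ Γ, IsCorkscrew Ω (Qreg Ω lam₀ (θΓ xb) xb) xb η₀ (θΓ xb) δΓ)
    (ε : ℝ → ℝ) (hεmono : ∀ a b : ℝ, 0 < a → a ≤ b → b < 1 → ε a ≤ ε b)
    (H2 : ∀ xb ∈ Γ, ConnectedTo Ω (Ω ∩ ball xb δΓ) xb CΓ (θΓ xb) (δΓ / (3 * CΓ)) ε)
    (H4' : ∀ xb ∈ Γ, ∀ ρ : ℝ, 0 < ρ → μH[t] (Γ ∩ ball xb ρ) ≤ ENNReal.ofReal (AΓ * ρ ^ t))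
    (H4'' : ∀ xb ∈ Γ, ∀ ρ : ℝ, 0 < ρ → ENNReal.ofReal ρ ≤ EMetric.diam Γ →
      ENNReal.ofReal (AΓ⁻¹ * ρ ^ t) ≤ μH[t] (Γ ∩ ball xb ρ))
    (u : Euc n → ℝ) (hu : MemN Ω s p u)
    (xb₀ : Euc n) (hxb₀ : xb₀ ∈ Γ)
    (δ' ρ' ω : ℝ) (hδ'0 : 0 < δ') (hδ'Γ : δ' ≤ δΓ) (hρ'0 : 0 < ρ')
    (hω : ω < t - n * (θΓ xb₀ - 1))
    (hsub : frontier Ω ∩ ball xb₀ ρ' ⊆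
      {xb ∈ Γ | 0 ≤ alphaLow Ω s p θΓ xb δ' + ω} ∩ GammaTau Ω s p u Γ t)
    (Tu : Euc n → ℝ) (hTum : AEMeasurable Tu (μH[t].restrict (Γ ∩ ball xb₀ ρ')))
    (hTu : ∀ xb ∈ Γ ∩ ball xb₀ ρ',
      Tendsto (gFun Ω u) (𝓝[Qreg Ω lam₀ (θΓ xb) xb] xb) (𝓝 (Tu xb))) :
    Tendsto (fun ρ : ℝ => ⨍ x in Ω ∩ ball xb₀ ρ, |Tu xb₀ - u x| ^ p)
      (𝓝[>] (0:ℝ)) (𝓝 0) := by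
  have hu1 := hu.1
  obtain ⟨sb, hsb⟩ := hsb
  have hp0 : 0 < p := by linarith
  have hx₀fr : xb₀ ∈ frontier Ω := hΓfr hxb₀
  have hv := aux_vol_pos (n := n)
  have hn0 : (0:ℝ) ≤ n := Nat.cast_nonneg n
  set θ₀ := θΓ xb₀ with hθ₀
  have hθ₀1 : 1 ≤ θ₀ := hθ1 xb₀
  have hωt : ω < t := by nlinarith [mul_nonneg hn0 (sub_nonneg.2 hθ₀1)]
  have hωn : 0 < (n:ℝ) - ω := by linarith
  have hη8 : 0 < η₀ / 8 := by positivity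
  have hη81 : η₀ / 8 < 1 := by linarith
  have hε0 : 0 < ε (η₀ / 8) := (H2 xb₀ hxb₀ (η₀ / 8) hη8 hη81).1
  set C : ℝ := (((2 * 4 ^ n) ^ p * 2 ^ (p * sb) * 6 ^ n / volume.real (ball (0 : Euc n) 1)) *
        (ε (η₀ / 8) ^ (-(n + p)) + (1 + CΓ) ^ (p * sb)) * (20 * CΓ + (1 + CΓ)) ^ p) with hC
  have hCpos : 0 < C := by positivity
  set R₁ : ℝ := min (δΓ / (3 * CΓ)) (min (δ' / (2 * (1 + CΓ))) (1 / (2 * (1 + CΓ)))) with hR₁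
  have hR₁pos : 0 < R₁ := by
    refine lt_min ?_ (lt_min ?_ ?_) <;> positivity
  have hR₁a : R₁ ≤ δΓ / (3 * CΓ) := min_le_left _ _
  have hR₁b : R₁ ≤ δ' / (2 * (1 + CΓ)) := (min_le_right _ _).trans (min_le_left _ _)
  have hR₁c : R₁ ≤ 1 / (2 * (1 + CΓ)) := (min_le_right _ _).trans (min_le_right _ _)
  have hR₁d : R₁ ≤ δΓ := hR₁a.trans (div_le_self hδΓ0.le (by linarith))
  have hR₁e : R₁ ≤ δ' := hR₁b.trans (div_le_self hδ'0.le (by linarith))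
  rw [le_div_iff₀ (by positivity)] at hR₁b hR₁c
  set Λ : ℝ := 2 * (1 + CΓ) with hΛ
  have hΛ0 : 0 < Λ := by positivity
  have hcork : ∀ zb ∈ frontier Ω ∩ ball xb₀ ρ', ∀ δ : ℝ, 0 < δ → δ ≤ R₁ →
      ∃ y ∈ Ω, dist y zb < δ ∧ (η₀ * δ) ^ θΓ zb < dB Ω y := by
    intro zb hzb δ hδ hδ1
    obtain ⟨y, hyQ, -, hyd, hyθ⟩ := H1 zb (hsub hzb).1.1 δ hδ (hδ1.trans hR₁d)
    exact ⟨y, hyQ.1, by rwa [dist_comm], hyθ⟩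
  have hlink : ∀ zb ∈ frontier Ω ∩ ball xb₀ ρ', ∀ R : ℝ, 0 < R → R ≤ R₁ → ∀ a ∈ Ω, ∀ b ∈ Ω,
      dist a zb < R → dist b zb < R → (η₀ / 8 * R) ^ θΓ zb ≤ dB Ω a →
      (η₀ / 8 * R) ^ θΓ zb ≤ dB Ω b →
      |gFun Ω u a - gFun Ω u b| ^ p ≤ C * R ^ (-ω) * nuM Ω s p u (ball zb (Λ * R)) := by
    intro zb hzb R hR hRR a ha b hb had hbd hda hdb
    have hR3 : R * Λ ≤ R₁ * Λ := mul_le_mul_of_nonneg_right hRR hΛ0.le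
    exact aux_link hn hΩo hfr hp hs0 hsb hu hCΓ hδΓ0 (hθ1 zb) hη8 hη81 hzb.1
      (H2 zb (hsub hzb).1.1) (hsub hzb).1.2 hR (hRR.trans hR₁a) (by linarith)
      (by linarith) ha hb had hbd hda hdb
  -- the ratio
  set q : ℝ := 2 ^ (-(((n:ℝ) - ω) / 2)) with hqdef
  have hq : 0 < q := by positivity
  have hq1 : q < 1 := Real.rpow_lt_one_of_one_lt_of_neg (by norm_num) (by linarith)
  have hq2 : q ^ 2 * 2 ^ ((n:ℝ) - ω) = 1 := by
    rw [← Real.rpow_natCast q 2, hqdef, ← Real.rpow_mul (by norm_num),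
      ← Real.rpow_add (by norm_num)]
    push_cast
    rw [show -(((n:ℝ) - ω) / 2) * 2 + (n - ω) = 0 by ring, Real.rpow_zero]
  have hq'1 : q ^ (1 / p) < 1 := Real.rpow_lt_one hq.le hq1 (by positivity)
  set C7 : ℝ := C * (1 / (1 - q ^ (1 / p))) ^ p with hC7
  have hC7pos : 0 < C7 := by
    have : 0 < 1 - q ^ (1 / p) := by linarith
    positivity
  have := aux_nuMeas_finite hu
  set ν := nuMeas Ω s p u with hν
  -- corkscrew points at `xb₀`
  have hX : ∀ ρ : ℝ, ∃ x, 0 < ρ → ρ ≤ δΓ → x ∈ Qreg Ω lam₀ θ₀ xb₀ ∧ dist xb₀ x < ρ ∧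
      (η₀ * ρ) ^ θ₀ < dB Ω x := by
    intro ρ
    by_cases h : 0 < ρ ∧ ρ ≤ δΓ
    · obtain ⟨x, hx1, -, hx2, hx3⟩ := H1 xb₀ hxb₀ ρ h.1 h.2
      exact ⟨x, fun _ _ => ⟨hx1, hx2, hx3⟩⟩
    · exact ⟨0, fun h1 h2 => absurd ⟨h1, h2⟩ h⟩
  choose X hXp using hX
  have hx₀mem : xb₀ ∈ frontier Ω ∩ ball xb₀ ρ' := ⟨hx₀fr, mem_ball_self hρ'0⟩
  -- growth of `ν` at `xb₀`
  obtain ⟨M, ρ₂, hρ₂, hM0, hM⟩ : ∃ M ρ₂ : ℝ, 0 < ρ₂ ∧ 0 ≤ M ∧ ∀ ρ, 0 < ρ → ρ < ρ₂ →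
      nuM Ω s p u (ball xb₀ ρ) ≤ M * ρ ^ t := by
    obtain ⟨M, hM⟩ := (hsub hx₀mem).2.2
    obtain ⟨ρ₂, hρ₂, hM⟩ := (mem_nhdsGT_iff_exists_Ioo_subset).1 hM
    refine ⟨max M 0, ρ₂, hρ₂, le_max_right _ _, fun ρ h1 h2 => ?_⟩
    have h3 : ρ ^ (-t) * nuM Ω s p u (ball xb₀ ρ) ≤ M := hM ⟨h1, h2⟩
    have h4 : 0 < ρ ^ t := by positivity
    rw [Real.rpow_neg h1.le, inv_mul_le_iff₀ h4] at h3
    refine h3.trans ?_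
    rw [mul_comm]
    gcongr
    exact le_max_left _ _
  set C9 : ℝ := 1 + 8 * (Λ + 1) with hC9
  have hC91 : 1 ≤ C9 := by linarith
  set c0 : ℝ := (η₀ / 2) ^ (n * θ₀) * volume.real (ball (0 : Euc n) 1) with hc0
  have hc0pos : 0 < c0 := by positivity
  set A1 : ℝ := 8 ^ ((n:ℝ) - ω) * (Λ + 1) ^ n * volume.real (ball (0 : Euc n) 1) / (1 - q) with hA1
  have h1q : 0 < 1 - q := by linarith
  have hA10 : 0 ≤ A1 := by positivity
  set C10 : ℝ := 3 ^ p * C7 * A1 * (M * C9 ^ t) + 3 ^ p * (4 ^ n) ^ p * M with hC10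
  have hC100 : 0 ≤ C10 := by positivity
  set ρ₃ : ℝ := min (R₁ / 8) (min (ρ' / 2) (min (1 / 8) (ρ₂ / C9))) with hρ₃
  have hρ₃pos : 0 < ρ₃ := by
    refine lt_min ?_ (lt_min ?_ (lt_min ?_ ?_)) <;> positivity
  have key : ∀ ρ, 0 < ρ → ρ < ρ₃ → ⨍ x in Ω ∩ ball xb₀ ρ, |Tu xb₀ - u x| ^ p ≤
      3 ^ p * |Tu xb₀ - gFun Ω u (X ρ)| ^ p + C10 / c0 * ρ ^ ((n:ℝ) - ω + t - n * θ₀) := by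
    intro ρ hρ hρlt
    have ha1 : ρ < R₁ / 8 := hρlt.trans_le (min_le_left _ _)
    have ha2 : ρ < ρ' / 2 := hρlt.trans_le ((min_le_right _ _).trans (min_le_left _ _))
    have ha3 : ρ < 1 / 8 := hρlt.trans_le
      ((min_le_right _ _).trans ((min_le_right _ _).trans (min_le_left _ _)))
    have ha4 : ρ < ρ₂ / C9 := hρlt.trans_le
      ((min_le_right _ _).trans ((min_le_right _ _).trans (min_le_right _ _)))
    rw [lt_div_iff₀ (by positivity)] at ha4
    obtain ⟨hXQ, hXd, hXθ⟩ := hXp ρ hρ (by linarith)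
    set D := Ω ∩ ball xb₀ ρ with hD
    have hDm : MeasurableSet D := hΩo.measurableSet.inter measurableSet_ball
    have hDfin : volume D ≠ ∞ :=
      ((measure_mono inter_subset_right).trans_lt measure_ball_lt_top).ne
    have hvol : c0 * ρ ^ (n * θ₀) ≤ volume.real D := by
      obtain ⟨hYQ, hYd, hYθ⟩ := hXp (ρ / 2) (by linarith) (by linarith)
      exact aux_vol_lower hn hρ (by linarith) hη₀ hη₀1 hθ₀1 hYQ.1 hYd hYθ
    -- pointwise bound
    have hSpt : ∀ x ∈ D, ENNReal.ofReal (|gFun Ω u (X ρ) - gFun Ω u x| ^ p) ≤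
        ENNReal.ofReal C7 * SFun ν ω (Λ + 1) q ρ x := by
      intro x hx
      by_cases htop : SFun ν ω (Λ + 1) q ρ x = ∞
      · rw [htop, ENNReal.mul_top (by simpa using hC7pos)]
        exact le_top
      · have hTk : ∀ k : ℕ, (8 * ρ / 2 ^ k) ^ (-ω) *
            nuM Ω s p u (ball x ((Λ + 1) * (8 * ρ / 2 ^ k))) ≤
            (SFun ν ω (Λ + 1) q ρ x).toReal * q ^ k := by
          intro k
          have h1 : ENNReal.ofReal ((q ^ k)⁻¹ * (8 * ρ / 2 ^ k) ^ (-ω)) *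
              ν (ball x ((Λ + 1) * (8 * ρ / 2 ^ k))) ≤ SFun ν ω (Λ + 1) q ρ x :=
            ENNReal.le_tsum (f := fun k : ℕ => ENNReal.ofReal ((q ^ k)⁻¹ *
              (8 * ρ / 2 ^ k) ^ (-ω)) * ν (ball x ((Λ + 1) * (8 * ρ / 2 ^ k)))) k
          rw [hν, aux_nuMeas_ball hu, ← ENNReal.ofReal_mul (by positivity),
            ENNReal.ofReal_le_iff_le_toReal htop, mul_assoc, inv_mul_le_iff₀ (by positivity)] at h1
          rw [mul_comm _ (q ^ k)]
          exact h1
        have h2 := aux_pointwise hΩo hfr (f := gFun Ω u) (Nn := nuM Ω s p u)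
          (fun E F h => aux_nuM_mono hu h) hθ1 hp hη₀ hη₀1 hCpos hx₀fr hcork hlink hρ
          (by linarith) (by linarith) (by linarith) hXQ.1 (by rw [dist_comm]; exact hXd) hXθ
          hx.1 hx.2 hq hq1 ENNReal.toReal_nonneg hTk
        calc _ ≤ ENNReal.ofReal (C7 * (SFun ν ω (Λ + 1) q ρ x).toReal) :=
              ENNReal.ofReal_le_ofReal h2
          _ = _ := by rw [ENNReal.ofReal_mul hC7pos.le, ENNReal.ofReal_toReal htop]
    have hupt : ∀ x ∈ D, |gFun Ω u x - u x| ^ p ≤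
        (4 ^ n) ^ p * ρ ^ ((n:ℝ) - ω) * nuInt Ω s p u x := by
      intro x hx
      have hxd : dist x xb₀ < ρ := hx.2
      have hdpos := aux_dB_pos hΩo hfr hx.1
      have hdρ : dB Ω x ≤ ρ := (infDist_le_dist_of_mem hx₀fr).trans hxd.le
      have hσs := aux_sLow_le (s := s) (δ := δ') hs0 hx.1 (zb := xb₀) (by linarith)
      have hσ0 := aux_sLow_nonneg (Ω := Ω) hs0 xb₀ δ'
      have hal := (aux_alpha hθ₀1 (hsub hx₀mem).1.2).1
      have hnn := aux_nuInt_nonneg Ω s p u x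
      rw [abs_sub_comm]
      calc |u x - gFun Ω u x| ^ p ≤ (4 ^ n * hFun Ω u x) ^ p := by
            gcongr
            exact aux_u_sub_g_self hn hu1 hx.1 hdpos
        _ = (4 ^ n) ^ p * (nuInt Ω s p u x * dB Ω x ^ (p * s x)) := by
            rw [Real.mul_rpow (by positivity) (aux_hFun_nonneg _ _ _), aux_hFun_pow s p u hdpos]
        _ ≤ (4 ^ n) ^ p * (nuInt Ω s p u x * ρ ^ ((n:ℝ) - ω)) := by
            gcongr
            calc dB Ω x ^ (p * s x) ≤ ρ ^ (p * s x) :=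
                  Real.rpow_le_rpow hdpos.le hdρ (mul_nonneg hp0.le (hs0 x))
              _ ≤ ρ ^ ((n:ℝ) - ω) := by
                  apply Real.rpow_le_rpow_of_exponent_ge hρ (by linarith)
                  have : p * sLow Ω s xb₀ δ' ≤ p * s x := by gcongr
                  linarith
        _ = _ := by ring
    set E0 : ℝ := |Tu xb₀ - gFun Ω u (X ρ)| ^ p with hE0
    have hE00 : 0 ≤ E0 := by positivity
    have hpt : ∀ x ∈ D, ENNReal.ofReal (|Tu xb₀ - u x| ^ p) ≤
        ENNReal.ofReal (3 ^ p * E0) + (ENNReal.ofReal (3 ^ p * C7) * SFun ν ω (Λ + 1) q ρ x +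
          ENNReal.ofReal (3 ^ p * (4 ^ n) ^ p * ρ ^ ((n:ℝ) - ω)) *
            ENNReal.ofReal (nuInt Ω s p u x)) := by
      intro x hx
      have h1 : |Tu xb₀ - u x| ^ p ≤ 3 ^ p * E0 + 3 ^ p * |gFun Ω u (X ρ) - gFun Ω u x| ^ p +
          3 ^ p * |gFun Ω u x - u x| ^ p := by
        refine le_trans ?_ (aux_three hp0.le (abs_nonneg _) (abs_nonneg _) (abs_nonneg _))
        gcongr
        have h2 := abs_sub_le (Tu xb₀) (gFun Ω u (X ρ)) (u x)
        have h3 := abs_sub_le (gFun Ω u (X ρ)) (gFun Ω u x) (u x)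
        linarith
      refine (ENNReal.ofReal_le_ofReal h1).trans ?_
      rw [ENNReal.ofReal_add (by positivity) (by positivity),
        ENNReal.ofReal_add (by positivity) (by positivity), add_assoc]
      gcongr ?_ + (?_ + ?_)
      · exact le_rfl
      · rw [ENNReal.ofReal_mul (by positivity), ENNReal.ofReal_mul (by positivity), mul_assoc]
        gcongr
        exact hSpt x hx
      · rw [← ENNReal.ofReal_mul (by positivity)]
        apply ENNReal.ofReal_le_ofReal
        have := hupt x hx
        calc 3 ^ p * |gFun Ω u x - u x| ^ p ≤ 3 ^ p * ((4 ^ n) ^ p * ρ ^ ((n:ℝ) - ω) *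
              nuInt Ω s p u x) := by gcongr
          _ = _ := by ring
    -- integrate
    have hSm : Measurable (SFun ν ω (Λ + 1) q ρ) := by
      unfold SFun
      exact Measurable.tsum fun k => (aux_ball_meas ν _).const_mul _
    have hnuD : ∫⁻ x in D, ENNReal.ofReal (nuInt Ω s p u x) =
        ENNReal.ofReal (nuM Ω s p u (ball xb₀ ρ)) := by
      unfold nuM
      rw [ofReal_integral_eq_lintegral_ofReal (hu.2.mono_set inter_subset_left)
        (ae_of_all _ fun x => aux_nuInt_nonneg Ω s p u x)]
    have hN1 : nuM Ω s p u (ball xb₀ ρ) ≤ M * ρ ^ t := hM ρ hρ (by nlinarith)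
    have hN2 : nuM Ω s p u (ball xb₀ (C9 * ρ)) ≤ M * (C9 ^ t * ρ ^ t) := by
      rw [← Real.mul_rpow (by positivity) hρ.le]
      exact hM _ (by positivity) (by linarith)
    have hSint : ∫⁻ x in D, SFun ν ω (Λ + 1) q ρ x ≤
        ENNReal.ofReal (A1 * ρ ^ ((n:ℝ) - ω) * (M * (C9 ^ t * ρ ^ t))) := by
      refine (lintegral_mono_set inter_subset_right).trans ?_
      refine (aux_SFun_int hn ν (by positivity) hρ hq hq1 hq2 xb₀).trans ?_
      rw [hν, aux_nuMeas_ball hu, ← ENNReal.ofReal_mul (by positivity)]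
      apply ENNReal.ofReal_le_ofReal
      rw [Real.mul_rpow (by norm_num) hρ.le]
      calc _ = A1 * ρ ^ ((n:ℝ) - ω) * nuM Ω s p u (ball xb₀ (C9 * ρ)) := by
            rw [hA1, hC9]; ring
        _ ≤ _ := by gcongr
    have hlint : ∫⁻ x in D, ENNReal.ofReal (|Tu xb₀ - u x| ^ p) ≤
        ENNReal.ofReal (3 ^ p * E0 * volume.real D + C10 * ρ ^ ((n:ℝ) - ω + t)) := by
      refine (setLIntegral_mono' hDm hpt).trans ?_
      rw [lintegral_add_left measurable_const, lintegral_add_left (hSm.const_mul _),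
        lintegral_const_mul _ hSm, lintegral_const_mul' _ _ ENNReal.ofReal_ne_top, hnuD,
        lintegral_const, Measure.restrict_apply_univ, ← ofReal_measureReal hDfin,
        ← ENNReal.ofReal_mul (by positivity), ← ENNReal.ofReal_mul (by positivity),
        ENNReal.ofReal_add (by positivity) (by positivity)]
      gcongr
      calc _ ≤ ENNReal.ofReal (3 ^ p * C7) *
            ENNReal.ofReal (A1 * ρ ^ ((n:ℝ) - ω) * (M * (C9 ^ t * ρ ^ t))) +
            ENNReal.ofReal (3 ^ p * (4 ^ n) ^ p * ρ ^ ((n:ℝ) - ω) * (M * ρ ^ t)) := by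
            gcongr
        _ = _ := by
            rw [← ENNReal.ofReal_mul (by positivity), ← ENNReal.ofReal_add (by positivity)
              (by positivity), Real.rpow_add hρ, hC10]
            congr 1
            ring
    have hVpos : 0 < volume.real D := lt_of_lt_of_le (by positivity) hvol
    have hint : ∫ x in D, |Tu xb₀ - u x| ^ p ≤
        3 ^ p * E0 * volume.real D + C10 * ρ ^ ((n:ℝ) - ω + t) := by
      have hmeas : AEStronglyMeasurable (fun x => |Tu xb₀ - u x| ^ p) (volume.restrict D) := by
        have h1 : AEMeasurable u (volume.restrict D) :=
          (hu1.mono_set (inter_subset_left : D ⊆ Ω)).aemeasurable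
        exact (((aemeasurable_const.sub h1).abs).pow_const p).aestronglyMeasurable
      rw [integral_eq_lintegral_of_nonneg_ae (ae_of_all _ fun x => by positivity) hmeas]
      exact ENNReal.toReal_le_of_le_ofReal (by positivity) hlint
    rw [setAverage_eq, smul_eq_mul, inv_mul_le_iff₀ hVpos]
    refine hint.trans ?_
    rw [mul_add]
    have h5 : C10 * ρ ^ ((n:ℝ) - ω + t) ≤
        volume.real D * (C10 / c0 * ρ ^ ((n:ℝ) - ω + t - n * θ₀)) := by
      calc C10 * ρ ^ ((n:ℝ) - ω + t) = c0 * ρ ^ (n * θ₀) *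
            (C10 / c0 * ρ ^ ((n:ℝ) - ω + t - n * θ₀)) := by
            rw [Real.rpow_sub hρ]
            field_simp
        _ ≤ _ := by gcongr
    linarith
  -- conclusion
  have hXt : Tendsto X (𝓝[>] (0:ℝ)) (𝓝[Qreg Ω lam₀ θ₀ xb₀] xb₀) := by
    have hev : ∀ᶠ ρ in 𝓝[>] (0:ℝ), 0 < ρ ∧ ρ ≤ δΓ :=
      mem_of_superset (Ioc_mem_nhdsGT hδΓ0) fun _ h => h
    refine tendsto_nhdsWithin_iff.2 ⟨?_, ?_⟩
    · rw [tendsto_iff_dist_tendsto_zero]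
      have hid : Tendsto (fun ρ : ℝ => ρ) (𝓝[>] (0:ℝ)) (𝓝 0) := nhdsWithin_le_nhds
      refine squeeze_zero' (Eventually.of_forall fun _ => dist_nonneg) ?_ hid
      filter_upwards [hev] with ρ h
      rw [dist_comm]
      exact (hXp ρ h.1 h.2).2.1.le
    · filter_upwards [hev] with ρ h
      exact (hXp ρ h.1 h.2).1
  have hg : Tendsto (fun ρ => gFun Ω u (X ρ)) (𝓝[>] (0:ℝ)) (𝓝 (Tu xb₀)) :=
    (hTu xb₀ ⟨hxb₀, mem_ball_self hρ'0⟩).comp hXt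
  have hlim1 : Tendsto (fun ρ => 3 ^ p * |Tu xb₀ - gFun Ω u (X ρ)| ^ p) (𝓝[>] (0:ℝ)) (𝓝 0) := by
    have h1 : Tendsto (fun ρ => |Tu xb₀ - gFun Ω u (X ρ)|) (𝓝[>] (0:ℝ)) (𝓝 0) := by
      have := (tendsto_const_nhds (x := Tu xb₀)).sub hg
      simpa using this.abs
    have h2 := (h1.rpow_const (Or.inr hp0.le)).const_mul ((3:ℝ) ^ p)
    simpa [Real.zero_rpow hp0.ne'] using h2
  have hexp : 0 < (n:ℝ) - ω + t - n * θ₀ := by linarith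
  have hlim2 : Tendsto (fun ρ : ℝ => C10 / c0 * ρ ^ ((n:ℝ) - ω + t - n * θ₀))
      (𝓝[>] (0:ℝ)) (𝓝 0) := by
    have hid : Tendsto (fun ρ : ℝ => ρ) (𝓝[>] (0:ℝ)) (𝓝 0) := nhdsWithin_le_nhds
    have h2 := (hid.rpow_const (Or.inr hexp.le)).const_mul (C10 / c0)
    simpa [Real.zero_rpow hexp.ne'] using h2
  have hlim := hlim1.add hlim2
  rw [add_zero] at hlim
  refine squeeze_zero' (Eventually.of_forall fun ρ => ?_) ?_ hlim
  · rw [setAverage_eq]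
    exact smul_nonneg (by positivity) (integral_nonneg fun _ => by positivity)
  · filter_upwards [Ioo_mem_nhdsGT hρ₃pos] with ρ h
    exact key ρ h.1 h.2
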